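/- arXiv:2503.21550 — 3 statements merged into one kernel-verified Lean document; each statement's English description precedes it below -/
import Mathlib

section
/- Call an element α ∈ Δ_k⁺ simple in Δ_k⁺ if α is not the sum of two elements of Δ_k⁺. The simple elements of Δ_k⁺ are exactly φ₂, φ₃, φ₄, and δ. -/
noncomputable section

abbrev V : Type := Fin 4 → ℝ

def e (i : Fin 4) : V := Pi.single i 1

/-- The root system of type F₄ in ℝ⁴ (48 vectors). -/
def Δ : Set V :=
  (⋃ i, ({e i, -e i} : Set V)) ∪
  (⋃ (i) (j) (_ : i < j), ({e i + e j, e i - e j, -e i + e j, -e i - e j} : Set V)) ∪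
  {v | ∃ s : Fin 4 → ℝ, (∀ i, s i = 1 ∨ s i = -1) ∧ v = (1 / 2 : ℝ) • ∑ i, s i • e i}

def φ₁ : V := e 1 - e 2
def φ₂ : V := e 2 - e 3
def φ₃ : V := e 3
def φ₄ : V := (1 / 2 : ℝ) • (e 0 - e 1 - e 2 - e 3)

def φv : Fin 4 → V := ![φ₁, φ₂, φ₃, φ₄]

/-- The coordinates `n₁(α), …, n₄(α)` of `α` with respect to the basis φ₁,…,φ₄:
for every `α : V` one has `α = ∑ i, n α i • φv i`. -/
def n (α : V) : Fin 4 → ℝ :=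
  ![α 1 + α 0, α 1 + α 2 + 2 * α 0, α 1 + α 2 + α 3 + 3 * α 0, 2 * α 0]

/-- The highest root δ = 2φ₁+3φ₂+4φ₃+2φ₄ = e₁+e₂. -/
def δ : V := e 0 + e 1

/-- Compact roots: roots α with n₁(α) even. -/
def Δk : Set V := {α ∈ Δ | ∃ m : ℤ, n α 0 = 2 * m}

/-- Noncompact roots: roots α with n₁(α) odd. -/
def Δn : Set V := {α ∈ Δ | ∃ m : ℤ, n α 0 = 2 * m + 1}

/-- Δ⁺: roots with all φ-coefficients nonnegative. -/
def Δp : Set V := {α ∈ Δ | ∀ i, 0 ≤ n α i}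

def Δkp : Set V := Δp ∩ Δk
def Δnp : Set V := Δp ∩ Δn

/-- A positive system of Δ: the set of roots on which some root-regular linear
functional is positive. -/
def IsPosSystem (P : Set V) : Prop :=
  ∃ f : V →ₗ[ℝ] ℝ, (∀ α ∈ Δ, f α ≠ 0) ∧ P = {α ∈ Δ | 0 < f α}

/-- The positive compact roots: a positive system of type C₃ × A₁. -/
def compactPositiveRoots : Set V :=
  {φ₂, φ₃, φ₄, δ, φ₂ + φ₃, φ₃ + φ₄, φ₂ + φ₃ + φ₃, φ₂ + φ₃ + φ₄, φ₂ + φ₃ + φ₄ + φ₃,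
    φ₂ + φ₃ + φ₄ + φ₃ + φ₄}

theorem e_mem_Δ (i : Fin 4) : e i ∈ Δ := by
  refine Or.inl (Or.inl (Set.mem_iUnion.2 ⟨i, ?_⟩))
  simp

theorem e_add_mem_Δ {i j : Fin 4} (h : i < j) : e i + e j ∈ Δ := by
  refine Or.inl (Or.inr ?_)
  simp only [Set.mem_iUnion]
  exact ⟨i, j, h, by simp⟩

theorem e_sub_mem_Δ {i j : Fin 4} (h : i < j) : e i - e j ∈ Δ := by
  refine Or.inl (Or.inr ?_)
  simp only [Set.mem_iUnion]
  exact ⟨i, j, h, by simp⟩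

theorem half_sum_mem_Δ {s : Fin 4 → ℝ} (hs : ∀ i, s i = 1 ∨ s i = -1) :
    (1 / 2 : ℝ) • ∑ i, s i • e i ∈ Δ :=
  Or.inr ⟨s, hs, rfl⟩

theorem half_mem_Δ {a b : ℝ} (ha : a = 1 ∨ a = -1) (hb : b = 1 ∨ b = -1) :
    (![1 / 2, -1 / 2, a / 2, b / 2] : V) ∈ Δ := by
  have h := half_sum_mem_Δ (s := ![1, -1, a, b]) (by simp [Fin.forall_fin_succ, ha, hb])
  convert h using 1
  ext i
  fin_cases i <;> simp [Fin.sum_univ_four, e] <;> ring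

theorem compactPositiveRoots_subset_Δ : compactPositiveRoots ⊆ Δ := by
  have coord : ∀ {v w : V}, w ∈ Δ → (∀ i, v i = w i) → v ∈ Δ :=
    fun hw h => (funext h : _ = _) ▸ hw
  rintro α (rfl | rfl | rfl | rfl | rfl | rfl | rfl | rfl | rfl | rfl)
  · exact e_sub_mem_Δ (by decide)
  · exact e_mem_Δ 3
  · refine coord (half_mem_Δ (Or.inr rfl) (Or.inr rfl)) ?_
    simp [Fin.forall_fin_succ, φ₄, e]; norm_num
  · exact e_add_mem_Δ (by decide)
  · refine coord (e_mem_Δ 2) ?_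
    simp [φ₂, φ₃]
  · refine coord (half_mem_Δ (Or.inr rfl) (Or.inl rfl)) ?_
    simp [Fin.forall_fin_succ, φ₃, φ₄, e]; norm_num
  · refine coord (e_add_mem_Δ (i := 2) (j := 3) (by decide)) ?_
    simp [φ₂, φ₃]
  · refine coord (half_mem_Δ (Or.inl rfl) (Or.inr rfl)) ?_
    simp [Fin.forall_fin_succ, φ₂, φ₃, φ₄, e]; norm_num
  · refine coord (half_mem_Δ (Or.inl rfl) (Or.inl rfl)) ?_
    simp [Fin.forall_fin_succ, φ₂, φ₃, φ₄, e]; norm_num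
  · refine coord (e_sub_mem_Δ (i := 0) (j := 1) (by decide)) ?_
    simp [Fin.forall_fin_succ, φ₂, φ₃, φ₄, e]; norm_num

theorem compactPositiveRoots_subset_Δkp : compactPositiveRoots ⊆ Δkp := by
  intro α hα
  have hΔ := compactPositiveRoots_subset_Δ hα
  refine ⟨⟨hΔ, ?_⟩, hΔ, ?_⟩
  · rcases hα with rfl | rfl | rfl | rfl | rfl | rfl | rfl | rfl | rfl | rfl <;>
      simp [Fin.forall_fin_succ, n, δ, φ₂, φ₃, φ₄, e] <;> norm_num
  · by_cases hδ : α = δ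
    · exact ⟨1, by subst hδ; simp [n, δ, e]; norm_num⟩
    · refine ⟨0, ?_⟩
      rcases hα with rfl | rfl | rfl | rfl | rfl | rfl | rfl | rfl | rfl | rfl <;>
        first | exact absurd rfl hδ | simp [n, φ₂, φ₃, φ₄, e]

/-- The coordinate conditions defining the positive compact roots. -/
theorem coord_of_mem_Δkp {α : V} (hα : α ∈ Δkp) :
    0 ≤ α 1 + α 0 ∧ 0 ≤ α 1 + α 2 + 2 * α 0 ∧ 0 ≤ α 1 + α 2 + α 3 + 3 * α 0 ∧ 0 ≤ α 0 ∧
      α 1 + α 0 ≠ 1 := by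
  obtain ⟨⟨-, h⟩, -, m, hm⟩ := hα
  simp only [Fin.forall_fin_succ, n] at h
  simp at h
  refine ⟨h.1, h.2.1, h.2.2.1, h.2.2.2, fun h1 => ?_⟩
  have h2 : (1 : ℝ) = 2 * m := by simpa [n, h1] using hm
  have h3 : (1 : ℤ) = 2 * m := by exact_mod_cast h2
  omega

theorem cases_fin_four : ∀ i : Fin 4, i = 0 ∨ i = 1 ∨ i = 2 ∨ i = 3 := by
  decide

theorem Δkp_subset_compactPositiveRoots : Δkp ⊆ compactPositiveRoots := by
  intro α hα
  have hc := coord_of_mem_Δkp hα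
  have mem : ∀ v ∈ compactPositiveRoots, (∀ i, α i = v i) → α ∈ compactPositiveRoots :=
    fun v hv h => (funext h : α = v) ▸ hv
  rcases hα.1.1 with (hα | hα) | ⟨s, hs, hα⟩
  · obtain ⟨i, rfl | rfl⟩ := Set.mem_iUnion.1 hα <;>
      rcases cases_fin_four i with rfl | rfl | rfl | rfl <;> simp [e] at hc
    · exact mem (φ₂ + φ₃) (by simp [compactPositiveRoots]) (by simp [φ₂, φ₃])
    · exact mem φ₃ (by simp [compactPositiveRoots]) (by simp [φ₃])
    all_goals norm_num at hc
  · simp only [Set.mem_iUnion] at hα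
    obtain ⟨i, j, hij, rfl | rfl | rfl | rfl⟩ := hα <;>
      rcases cases_fin_four i with rfl | rfl | rfl | rfl <;>
      rcases cases_fin_four j with rfl | rfl | rfl | rfl <;>
      simp [e] at hc hij
    · exact mem δ (by simp [compactPositiveRoots]) (by simp [δ])
    · exact mem (φ₂ + φ₃ + φ₃) (by simp [compactPositiveRoots]) (by simp [φ₂, φ₃])
    · exact mem (φ₂ + φ₃ + φ₄ + φ₃ + φ₄) (by simp [compactPositiveRoots])
        (by simp [Fin.forall_fin_succ, φ₂, φ₃, φ₄, e]; norm_num)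
    · exact mem φ₂ (by simp [compactPositiveRoots]) (by simp [φ₂])
    all_goals norm_num at hc
  · have hcoord : ∀ i, α i = s i / 2 := by
      subst hα
      intro i
      fin_cases i <;> simp [Fin.sum_univ_four, e] <;> ring
    simp only [hcoord] at hc mem
    obtain ⟨-, -, -, h4, hne⟩ := hc
    have h0 : s 0 = 1 := (hs 0).resolve_right fun h => by norm_num [h] at h4
    have h1 : s 1 = -1 := (hs 1).resolve_left fun h => by norm_num [h, h0] at hne
    rcases hs 2 with h2 | h2 <;> rcases hs 3 with h3 | h3
    · refine mem (φ₂ + φ₃ + φ₄ + φ₃) (by simp [compactPositiveRoots]) ?_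
      simp [Fin.forall_fin_succ, h0, h1, h2, h3, φ₂, φ₃, φ₄, e]; norm_num
    · refine mem (φ₂ + φ₃ + φ₄) (by simp [compactPositiveRoots]) ?_
      simp [Fin.forall_fin_succ, h0, h1, h2, h3, φ₂, φ₃, φ₄, e]; norm_num
    · refine mem (φ₃ + φ₄) (by simp [compactPositiveRoots]) ?_
      simp [Fin.forall_fin_succ, h0, h1, h2, h3, φ₃, φ₄, e]; norm_num
    · refine mem φ₄ (by simp [compactPositiveRoots]) ?_
      simp [Fin.forall_fin_succ, h0, h1, h2, h3, φ₄, e]; norm_num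

theorem Δkp_eq_compactPositiveRoots : Δkp = compactPositiveRoots :=
  Δkp_subset_compactPositiveRoots.antisymm compactPositiveRoots_subset_Δkp

/-- The height with respect to `φ₂`, `φ₃`, `φ₄`, `δ`. -/
def compactHeight (α : V) : ℝ := n α 1 + n α 2 + n α 3 - 4 * n α 0

theorem compactHeight_add (α β : V) :
    compactHeight (α + β) = compactHeight α + compactHeight β := by
  simp [compactHeight, n]; ring

theorem one_le_compactHeight {α : V} (hα : α ∈ compactPositiveRoots) : 1 ≤ compactHeight α := by
  rcases hα with rfl | rfl | rfl | rfl | rfl | rfl | rfl | rfl | rfl | rfl <;>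
    simp [compactHeight, n, δ, φ₂, φ₃, φ₄, e] <;> norm_num

theorem compactHeight_eq_one {α : V} (hα : α ∈ ({φ₂, φ₃, φ₄, δ} : Set V)) :
    compactHeight α = 1 := by
  rcases hα with rfl | rfl | rfl | rfl <;>
    simp [compactHeight, n, δ, φ₂, φ₃, φ₄, e] <;> norm_num

theorem stmt2 :
    {α ∈ Δkp | ¬ ∃ β ∈ Δkp, ∃ γ ∈ Δkp, α = β + γ} = ({φ₂, φ₃, φ₄, δ} : Set V) := by
  rw [Δkp_eq_compactPositiveRoots]
  ext α
  constructor
  · rintro ⟨hα, hsimple⟩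
    rcases hα with rfl | rfl | rfl | rfl | rfl | rfl | rfl | rfl | rfl | rfl
    iterate 4 simp
    all_goals
      exact absurd ⟨_, by simp [compactPositiveRoots], _, by simp [compactPositiveRoots], rfl⟩
        hsimple
  · intro hα
    refine ⟨?_, ?_⟩
    · rcases hα with rfl | rfl | rfl | rfl <;> simp [compactPositiveRoots]
    · rintro ⟨β, hβ, γ, hγ, rfl⟩
      have h := compactHeight_eq_one hα
      rw [compactHeight_add] at h
      linarith [one_le_compactHeight hβ, one_le_compactHeight hγ]
end
end

section
/- There are exactly 12 positive systems of Δ that contain Δ_k⁺. -/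
noncomputable section

/-- Twice one representative of each pair `±α` of roots, as integer vectors. -/
def rootReps : List (Fin 4 → ℤ) :=
  [![2, 0, 0, 0], ![0, 2, 0, 0], ![0, 0, 2, 0], ![0, 0, 0, 2],
   ![2, 2, 0, 0], ![2, -2, 0, 0], ![2, 0, 2, 0], ![2, 0, -2, 0], ![2, 0, 0, 2], ![2, 0, 0, -2],
   ![0, 2, 2, 0], ![0, 2, -2, 0], ![0, 2, 0, 2], ![0, 2, 0, -2], ![0, 0, 2, 2], ![0, 0, 2, -2],
   ![1, 1, 1, 1], ![1, 1, 1, -1], ![1, 1, -1, 1], ![1, 1, -1, -1],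
   ![1, -1, 1, 1], ![1, -1, 1, -1], ![1, -1, -1, 1], ![1, -1, -1, -1]]

/-- The standard bilinear pairing of `x` with an integer vector. -/
def pairing {R : Type*} [CommRing R] (x : Fin 4 → R) (r : Fin 4 → ℤ) : R :=
  x 0 * r 0 + x 1 * r 1 + x 2 * r 2 + x 3 * r 3

theorem pairing_vec {R : Type*} [CommRing R] (x : Fin 4 → R) (a b c d : ℤ) :
    pairing x ![a, b, c, d] = x 0 * a + x 1 * b + x 2 * c + x 3 * d :=
  rfl

/-- One integral regular vector in each Weyl chamber of `Δ` inside the positive chamber of `Δk`. -/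
def weight : Fin 12 → Fin 4 → ℤ :=
  ![![7, 3, 2, 1], ![7, 2, 3, 1], ![7, 1, 3, 2], ![7, -1, 3, 2], ![5, -1, 3, 2], ![7, -2, 3, 1],
    ![5, -2, 3, 1], ![5, -3, 4, 1], ![4, -3, 5, 1], ![7, -3, 2, 1], ![5, -3, 2, 1], ![5, -4, 3, 1]]

def realWeight (k : Fin 12) : V := fun i => (weight k i : ℝ)

/-- The roots that pair positively with `x`. -/
def posRoots (x : V) : Set V := {α ∈ Δ | 0 < x ⬝ᵥ α}

theorem rootReps_cases : ∀ r ∈ rootReps,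
    (∃ i, r = Pi.single i 2) ∨
    (∃ i j, i < j ∧ (r = Pi.single i 2 + Pi.single j 2 ∨ r = Pi.single i 2 - Pi.single j 2)) ∨
    ∀ i, r i = 1 ∨ r i = -1 := by
  decide +kernel

theorem half_single_two (i j : Fin 4) : ((Pi.single i 2 : Fin 4 → ℤ) j : ℝ) / 2 = e i j := by
  by_cases h : j = i <;> simp [e, h]

theorem mem_Δ_of_rep {r : Fin 4 → ℤ} (hr : r ∈ rootReps) : (fun i => (r i : ℝ) / 2) ∈ Δ := by
  rcases rootReps_cases r hr with ⟨i, rfl⟩ | ⟨i, j, hij, h⟩ | h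
  · refine Or.inl (Or.inl (Set.mem_iUnion.2 ⟨i, Or.inl ?_⟩))
    exact funext fun k => half_single_two i k
  · refine Or.inl (Or.inr ?_)
    simp only [Set.mem_iUnion]
    refine ⟨i, j, hij, ?_⟩
    rcases h with rfl | rfl
    · exact Or.inl (funext fun k => by simp [add_div, half_single_two])
    · exact Or.inr (Or.inl (funext fun k => by simp [sub_div, half_single_two]))
  · refine Or.inr ⟨fun i => r i, fun i => (h i).imp (by simp [·]) (by simp [·]), funext fun i => ?_⟩
    fin_cases i <;> simp [Fin.sum_univ_four, e, div_eq_inv_mul]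

theorem single_mem_rootReps : ∀ i, Pi.single i 2 ∈ rootReps := by
  decide +kernel

theorem single_add_single_mem_rootReps : ∀ i j, i < j →
    Pi.single i 2 + Pi.single j 2 ∈ rootReps ∧ Pi.single i 2 - Pi.single j 2 ∈ rootReps := by
  decide +kernel

theorem signs_mem_rootReps : ∀ b : Fin 4 → Bool,
    (fun i => if b i then 1 else -1) ∈ rootReps ∨ (fun i => if b i then -1 else 1) ∈ rootReps := by
  decide +kernel

theorem exists_rep {α : V} (hα : α ∈ Δ) :
    ∃ r ∈ rootReps, (∀ i, 2 * α i = r i) ∨ ∀ i, 2 * α i = -r i := by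
  have two_e (i k : Fin 4) : ((Pi.single i 2 : Fin 4 → ℤ) k : ℝ) = 2 * e i k := by
    rw [← half_single_two]
    ring
  rcases hα with (h | h) | ⟨s, hs, rfl⟩
  · obtain ⟨i, h | h⟩ := Set.mem_iUnion.1 h <;> subst h
    · exact ⟨_, single_mem_rootReps i, Or.inl fun k => (two_e i k).symm⟩
    · exact ⟨_, single_mem_rootReps i, Or.inr fun k => by simp [two_e]⟩
  · simp only [Set.mem_iUnion] at h
    obtain ⟨i, j, hij, h⟩ := h
    obtain ⟨hadd, hsub⟩ := single_add_single_mem_rootReps i j hij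
    rcases h with h | h | h | h <;> subst h
    · exact ⟨_, hadd, Or.inl fun k => by simp [two_e]; ring⟩
    · exact ⟨_, hsub, Or.inl fun k => by simp [two_e]; ring⟩
    · exact ⟨_, hsub, Or.inr fun k => by simp [two_e]; ring⟩
    · exact ⟨_, hadd, Or.inr fun k => by simp [two_e]; ring⟩
  · classical
    have coord (i : Fin 4) : 2 * ((1 / 2 : ℝ) • ∑ j, s j • e j) i = s i := by
      fin_cases i <;> simp [Fin.sum_univ_four, e]
    rcases signs_mem_rootReps fun i => decide (s i = 1) with h | h
    · refine ⟨_, h, Or.inl fun i => (coord i).trans ?_⟩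
      rcases hs i with h | h <;> norm_num [h]
    · refine ⟨_, h, Or.inr fun i => (coord i).trans ?_⟩
      rcases hs i with h | h <;> norm_num [h]

theorem pairing_eq_of_rep {x α : V} {r : Fin 4 → ℤ} (h : ∀ i, 2 * α i = r i) :
    pairing x r = 2 * (x ⬝ᵥ α) := by
  simp only [pairing, dotProduct, Fin.sum_univ_four, ← h]
  ring

theorem pairing_eq_of_neg_rep {x α : V} {r : Fin 4 → ℤ} (h : ∀ i, 2 * α i = -r i) :
    pairing x r = -2 * (x ⬝ᵥ α) := by
  have h' (i) : (r i : ℝ) = -(2 * α i) := by rw [h, neg_neg]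
  simp only [pairing, dotProduct, Fin.sum_univ_four, h']
  ring

theorem pairing_realWeight (k : Fin 12) (r : Fin 4 → ℤ) :
    pairing (realWeight k) r = (pairing (weight k) r : ℤ) := by
  simp [pairing, realWeight]

theorem isPosSystem_iff {P : Set V} :
    IsPosSystem P ↔ ∃ x : V, (∀ r ∈ rootReps, pairing x r ≠ 0) ∧ P = posRoots x := by
  constructor
  · rintro ⟨f, hf, rfl⟩
    have key (α : V) : f α = (fun i => f (e i)) ⬝ᵥ α := by
      rw [LinearMap.pi_apply_eq_sum_univ f α]
      refine Finset.sum_congr rfl fun i _ => ?_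
      rw [smul_eq_mul, mul_comm]
      congr 2
      ext j
      simp [e, Pi.single_apply, eq_comm]
    refine ⟨fun i => f (e i), fun r hr h => hf _ (mem_Δ_of_rep hr) ?_, ?_⟩
    · rw [key]
      have := pairing_eq_of_rep (x := fun i => f (e i)) (α := fun i => (r i : ℝ) / 2) (r := r)
        fun i => by ring
      linarith
    · ext α
      simp only [posRoots, Set.mem_ofPred_eq, ← key]
  · rintro ⟨x, hx, rfl⟩
    refine ⟨dotProductBilin ℝ ℝ x, fun α hα => ?_, rfl⟩
    obtain ⟨r, hr, h | h⟩ := exists_rep hα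
    · have := hx r hr
      rw [pairing_eq_of_rep h] at this
      exact right_ne_zero_of_mul this
    · have := hx r hr
      rw [pairing_eq_of_neg_rep h] at this
      exact right_ne_zero_of_mul this

theorem posRoots_eq_of_forall_pairing {x y : V}
    (h : ∀ r ∈ rootReps, 0 < pairing x r * pairing y r) : posRoots x = posRoots y := by
  ext α
  refine and_congr_right fun hα => ?_
  have hxy : 0 < (x ⬝ᵥ α) * (y ⬝ᵥ α) := by
    obtain ⟨r, hr, h' | h'⟩ := exists_rep hα
    · have := h r hr
      rw [pairing_eq_of_rep h', pairing_eq_of_rep h'] at this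
      linarith
    · have := h r hr
      rw [pairing_eq_of_neg_rep h', pairing_eq_of_neg_rep h'] at this
      linarith
  exact ⟨fun hx => pos_of_mul_pos_right hxy hx.le, fun hy => pos_of_mul_pos_left hxy hy.le⟩

theorem mem_posRoots_of_rep {x : V} {r : Fin 4 → ℤ} (hr : r ∈ rootReps) :
    (fun i => (r i : ℝ) / 2) ∈ posRoots x ↔ 0 < pairing x r := by
  rw [pairing_eq_of_rep (α := fun i => (r i : ℝ) / 2) fun i => by ring]
  simp [posRoots, (mem_Δ_of_rep hr)]

theorem posRoots_realWeight_injective :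
    Function.Injective fun k => posRoots (realWeight k) := by
  intro j k hjk
  have h : ∀ r ∈ rootReps, 0 < pairing (weight j) r ↔ 0 < pairing (weight k) r := by
    intro r hr
    have := Set.ext_iff.1 hjk fun i => (r i : ℝ) / 2
    simpa only [mem_posRoots_of_rep hr, pairing_realWeight, Int.cast_pos] using this
  clear hjk
  revert j k
  decide +kernel

theorem weight_mem_chamber : ∀ k, weight k 3 < weight k 2 ∧ 0 < weight k 3 ∧
    weight k 1 + weight k 2 + weight k 3 < weight k 0 ∧ 0 < weight k 0 + weight k 1 := by
  decide +kernel

theorem isPosSystem_posRoots_realWeight (k : Fin 12) :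
    IsPosSystem (posRoots (realWeight k)) := by
  refine isPosSystem_iff.2 ⟨_, fun r hr => ?_, rfl⟩
  rw [pairing_realWeight, Int.cast_ne_zero]
  revert k r
  decide +kernel

theorem forall_nonneg_n_iff {α : V} : (∀ i, 0 ≤ n α i) ↔ 0 ≤ α 1 + α 0 ∧
    0 ≤ α 1 + α 2 + 2 * α 0 ∧ 0 ≤ α 1 + α 2 + α 3 + 3 * α 0 ∧ 0 ≤ 2 * α 0 :=
  ⟨fun h => ⟨h 0, h 1, h 2, h 3⟩, fun ⟨_, _, _, _⟩ i => by fin_cases i <;> assumption⟩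

theorem mem_of_four_dvd_of_mem_rootReps : ∀ r ∈ rootReps, 4 ∣ r 0 + r 1 →
    r ∈ [![0, 0, 2, 0], ![0, 0, 0, 2], ![0, 0, 2, 2], ![0, 0, 2, -2], ![2, 2, 0, 0], ![2, -2, 0, 0],
      ![1, -1, 1, 1], ![1, -1, 1, -1], ![1, -1, -1, 1], ![1, -1, -1, -1]] := by
  decide +kernel

theorem not_nonpos_of_mem_rootReps : ∀ r ∈ rootReps,
    ¬(r 1 + r 0 ≤ 0 ∧ r 1 + r 2 + 2 * r 0 ≤ 0 ∧ r 1 + r 2 + r 3 + 3 * r 0 ≤ 0 ∧ 2 * r 0 ≤ 0) := by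
  decide +kernel

/-- The linear inequalities cutting out the positive chamber of `Δk`. -/
theorem Δkp_subset_posRoots_iff {x : V} : Δkp ⊆ posRoots x ↔
    x 3 < x 2 ∧ 0 < x 3 ∧ x 1 + x 2 + x 3 < x 0 ∧ 0 < x 0 + x 1 := by
  constructor
  · intro h
    have key (a b c d : ℤ) (hr : ![a, b, c, d] ∈ rootReps)
        (hn : 0 ≤ b + a ∧ 0 ≤ b + c + 2 * a ∧ 0 ≤ b + c + d + 3 * a ∧ 0 ≤ 2 * a)
        (m : ℤ) (hm : b + a = 4 * m) : 0 < pairing x ![a, b, c, d] := by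
      obtain ⟨n0, n1, n2, n3⟩ := hn
      refine (mem_posRoots_of_rep hr).1 (h ⟨⟨mem_Δ_of_rep hr, ?_⟩, mem_Δ_of_rep hr, m, ?_⟩)
      · rify at n0 n1 n2 n3
        simp only [forall_nonneg_n_iff, Matrix.cons_val]
        refine ⟨?_, ?_, ?_, ?_⟩ <;> linarith
      · rify at hm
        simp only [n, Matrix.cons_val]
        linarith
    have h1 := key 0 0 2 (-2) (by decide) (by norm_num) 0 (by norm_num)
    have h2 := key 0 0 0 2 (by decide) (by norm_num) 0 (by norm_num)
    have h3 := key 1 (-1) (-1) (-1) (by decide) (by norm_num) 0 (by norm_num)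
    have h4 := key 2 2 0 0 (by decide) (by norm_num) 1 (by norm_num)
    norm_num [pairing_vec] at h1 h2 h3 h4
    refine ⟨?_, ?_, ?_, ?_⟩ <;> linarith
  · rintro ⟨h1, h2, h3, h4⟩ α ⟨⟨hα, hn⟩, -, m, hm⟩
    refine ⟨hα, ?_⟩
    obtain ⟨r, hr, h | h⟩ := exists_rep hα
    · have hr0 : 4 ∣ r 0 + r 1 := by
        have := h 0
        have := h 1
        simp only [n, Matrix.cons_val_zero] at hm
        refine ⟨m, ?_⟩
        rify
        linarith
      suffices 0 < pairing x r by
        rw [pairing_eq_of_rep h] at this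
        linarith
      have hr' := mem_of_four_dvd_of_mem_rootReps r hr hr0
      simp only [List.mem_cons, List.not_mem_nil, or_false] at hr'
      rcases hr' with rfl | rfl | rfl | rfl | rfl | rfl | rfl | rfl | rfl | rfl <;>
        norm_num [pairing_vec] <;> linarith
    · exfalso
      have hn' : r 1 + r 0 ≤ 0 ∧ r 1 + r 2 + 2 * r 0 ≤ 0 ∧ r 1 + r 2 + r 3 + 3 * r 0 ≤ 0 ∧
          2 * r 0 ≤ 0 := by
        obtain ⟨n0, n1, n2, n3⟩ := forall_nonneg_n_iff.1 hn
        have := h 0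
        have := h 1
        have := h 2
        have := h 3
        rify
        refine ⟨?_, ?_, ?_, ?_⟩ <;> linarith
      exact not_nonpos_of_mem_rootReps r hr hn'

set_option maxHeartbeats 3000000 in
theorem exists_posRoots_eq {x : V} (hx : ∀ r ∈ rootReps, pairing x r ≠ 0)
    (hk : Δkp ⊆ posRoots x) : ∃ k, posRoots (realWeight k) = posRoots x := by
  obtain ⟨h1, h2, h3, h4⟩ := Δkp_subset_posRoots_iff.1 hk
  have sgn (a b c d : ℤ) (hr : ![a, b, c, d] ∈ rootReps) {t y : ℝ}
      (hy : pairing x ![a, b, c, d] = t * y) : 0 < y ∨ y < 0 := by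
    refine (lt_or_gt_of_ne fun h => hx _ hr ?_).symm
    rw [hy, h, mul_zero]
  have sgn_b : 0 < x 1 ∨ x 1 < 0 :=
    sgn 0 2 0 0 (by decide) (t := 2) (by norm_num [pairing_vec]; ring)
  have sgn_b_sub_c : 0 < x 1 - x 2 ∨ x 1 - x 2 < 0 :=
    sgn 0 2 (-2) 0 (by decide) (t := 2) (by norm_num [pairing_vec]; ring)
  have sgn_b_add_c : 0 < x 1 + x 2 ∨ x 1 + x 2 < 0 :=
    sgn 0 2 2 0 (by decide) (t := 2) (by norm_num [pairing_vec]; ring)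
  have sgn_b_sub_d : 0 < x 1 - x 3 ∨ x 1 - x 3 < 0 :=
    sgn 0 2 0 (-2) (by decide) (t := 2) (by norm_num [pairing_vec]; ring)
  have sgn_b_add_d : 0 < x 1 + x 3 ∨ x 1 + x 3 < 0 :=
    sgn 0 2 0 2 (by decide) (t := 2) (by norm_num [pairing_vec]; ring)
  have sgn_a_sub_c : 0 < x 0 - x 2 ∨ x 0 - x 2 < 0 :=
    sgn 2 0 (-2) 0 (by decide) (t := 2) (by norm_num [pairing_vec]; ring)
  have sgn_half : 0 < x 0 + x 1 - x 2 + x 3 ∨ x 0 + x 1 - x 2 + x 3 < 0 :=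
    sgn 1 1 (-1) 1 (by decide) (t := 1) (by norm_num [pairing_vec]; ring)
  have sgn_half' : 0 < x 0 + x 1 - x 2 - x 3 ∨ x 0 + x 1 - x 2 - x 3 < 0 :=
    sgn 1 1 (-1) (-1) (by decide) (t := 1) (by norm_num [pairing_vec]; ring)
  clear sgn hx hk
  suffices ∃ k, ∀ r ∈ rootReps, 0 < ((pairing (weight k) r : ℤ) : ℝ) * pairing x r by
    refine this.imp fun k hk => posRoots_eq_of_forall_pairing ?_
    simpa only [pairing_realWeight] using hk
  refine sgn_b_sub_c.elim (fun _ => ⟨0, ?_⟩) fun _ =>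
    sgn_b_sub_d.elim (fun _ => ⟨1, ?_⟩) fun _ =>
    sgn_b.elim (fun _ => ⟨2, ?_⟩) fun _ =>
    sgn_b_add_d.elim
      (fun _ => sgn_half'.elim (fun _ => ⟨3, ?_⟩) fun _ => ⟨4, ?_⟩) fun _ =>
    sgn_b_add_c.elim
      (fun _ => sgn_half'.elim (fun _ => ⟨5, ?_⟩) fun _ =>
        sgn_half.elim (fun _ => ⟨6, ?_⟩) fun _ =>
        sgn_a_sub_c.elim (fun _ => ⟨7, ?_⟩) fun _ => ⟨8, ?_⟩) fun _ =>
    sgn_half'.elim (fun _ => ⟨9, ?_⟩) fun _ =>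
    sgn_half.elim (fun _ => ⟨10, ?_⟩) fun _ => ⟨11, ?_⟩
  all_goals
    simp only [rootReps, List.forall_mem_cons, pairing_vec, weight, Matrix.cons_val,
      List.not_mem_nil, IsEmpty.forall_iff, implies_true, and_true]
    norm_num
    refine ⟨?_, ?_, ?_, ?_, ?_, ?_, ?_, ?_, ?_, ?_, ?_, ?_,
      ?_, ?_, ?_, ?_, ?_, ?_, ?_, ?_, ?_, ?_, ?_, ?_⟩ <;> linarith

theorem stmt4 : {P : Set V | IsPosSystem P ∧ Δkp ⊆ P}.ncard = 12 := by
  have : {P : Set V | IsPosSystem P ∧ Δkp ⊆ P} = Set.range fun k => posRoots (realWeight k) := by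
    ext P
    constructor
    · rintro ⟨hP, hk⟩
      obtain ⟨x, hx, rfl⟩ := isPosSystem_iff.1 hP
      exact exists_posRoots_eq hx hk
    · rintro ⟨k, rfl⟩
      refine ⟨isPosSystem_posRoots_realWeight k, Δkp_subset_posRoots_iff.2 ?_⟩
      simp only [realWeight]
      exact_mod_cast weight_mem_chamber k
  rw [this, ← Set.image_univ, Set.ncard_image_of_injective _ posRoots_realWeight_injective]
  simp
end
end

section
/- The set B = {φ₁+φ₂, −φ₁, φ₃, φ₄} is a base of Δ, and the positive system determined by B equals Δ_k⁺ ∪ {β ∈ Δ_n⁺ : β ≥ φ₁+φ₂} ∪ (−{β ∈ Δ_n⁺ : β ≤ φ₁}); in particular this positive system contains Δ_k⁺. -/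
noncomputable section

/-- `le' γ β` means γ ≤ β, i.e. β − γ is a nonnegative integer combination of φ₁,…,φ₄. -/
def le' (γ β : V) : Prop := ∃ c : Fin 4 → ℕ, β - γ = ∑ i, (c i : ℝ) • φv i

/-- A base of Δ: a linearly independent subset of Δ such that every root is an
integral combination with coefficients all ≥ 0 or all ≤ 0. -/
def IsBase (B : Finset V) : Prop :=
  ↑B ⊆ Δ ∧ LinearIndependent ℝ (Subtype.val : {x : V // x ∈ B} → V) ∧
  ∀ α ∈ Δ, ∃ c : V → ℤ,
    α = ∑ x ∈ B, (c x : ℝ) • x ∧ ((∀ x ∈ B, 0 ≤ c x) ∨ (∀ x ∈ B, c x ≤ 0))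

/-- The positive system determined by a base B: roots whose B-coefficients are all ≥ 0. -/
def posOf (B : Finset V) : Set V :=
  {α ∈ Δ | ∃ c : V → ℤ, α = ∑ x ∈ B, (c x : ℝ) • x ∧ ∀ x ∈ B, 0 ≤ c x}

@[simp] lemma n_zero (α : V) : n α 0 = α 1 + α 0 := rfl
@[simp] lemma n_one (α : V) : n α 1 = α 1 + α 2 + 2 * α 0 := rfl
@[simp] lemma n_two (α : V) : n α 2 = α 1 + α 2 + α 3 + 3 * α 0 := rfl
@[simp] lemma n_three (α : V) : n α 3 = 2 * α 0 := rfl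

lemma n_sub (α β : V) : n (α - β) = n α - n β := by
  funext i; fin_cases i <;> simp <;> ring

lemma n_neg (α : V) : n (-α) = -n α := by
  funext i; fin_cases i <;> simp <;> ring

lemma n_injective : Function.Injective n := by
  intro α β h
  have h0 := congrFun h 0
  have h1 := congrFun h 1
  have h2 := congrFun h 2
  have h3 := congrFun h 3
  simp only [n_zero, n_one, n_two, n_three] at h0 h1 h2 h3
  funext i
  fin_cases i <;> simp <;> linarith

lemma n_sum_smul_φv (x : Fin 4 → ℝ) : n (∑ i, x i • φv i) = x := by
  funext i
  fin_cases i <;>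
    simp [Fin.sum_univ_four, φv, φ₁, φ₂, φ₃, φ₄, e] <;> ring

lemma n_φ₁ : n φ₁ = ![1, 0, 0, 0] := by
  funext i; fin_cases i <;> simp [φ₁, e]

lemma n_φ₁_add_φ₂ : n (φ₁ + φ₂) = ![1, 1, 0, 0] := by
  funext i; fin_cases i <;> simp [φ₁, φ₂, e]

lemma le'_iff (γ β : V) : le' γ β ↔ ∃ c : Fin 4 → ℕ, ∀ i, n β i - n γ i = c i := by
  refine exists_congr fun c => ?_
  rw [← n_injective.eq_iff, n_sum_smul_φv fun i => (c i : ℝ), n_sub]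
  exact funext_iff

/-- The vectors of the base, as a family. -/
def baseVec : Fin 4 → V := ![φ₁ + φ₂, -φ₁, φ₃, φ₄]

lemma n_sum_smul_baseVec (a : Fin 4 → ℝ) :
    n (∑ i, a i • baseVec i) = ![a 0 - a 1, a 0, a 2, a 3] := by
  funext i
  fin_cases i <;>
    simp [Fin.sum_univ_four, baseVec, φ₁, φ₂, φ₃, φ₄, e] <;> ring

lemma linearIndependent_baseVec : LinearIndependent ℝ baseVec := by
  rw [Fintype.linearIndependent_iff]
  intro a ha
  have h := n_sum_smul_baseVec a
  rw [ha] at h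
  have h0 := congrFun h 0
  have h1 := congrFun h 1
  have h2 := congrFun h 2
  have h3 := congrFun h 3
  simp at h0 h1 h2 h3
  intro i
  fin_cases i <;> simp <;> linarith

lemma base_eq_image :
    ({φ₁ + φ₂, -(φ₁), φ₃, φ₄} : Finset V) = Finset.univ.image baseVec := by
  ext v
  simp [Fin.exists_fin_succ, baseVec, eq_comm]

/-- Expansions over the image of a base family are expansions over its index set. -/
lemma exists_coeff_image_iff (α : V) (p : (Fin 4 → ℤ) → Prop) :
    (∃ c : V → ℤ, α = ∑ x ∈ Finset.univ.image baseVec, (c x : ℝ) • x ∧ p (c ∘ baseVec)) ↔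
      ∃ a : Fin 4 → ℤ, n α = ![(a 0 : ℝ) - a 1, a 0, a 2, a 3] ∧ p a := by
  have hinj := linearIndependent_baseVec.injective
  simp only [Finset.sum_image hinj.injOn]
  constructor
  · rintro ⟨c, rfl, hp⟩
    exact ⟨c ∘ baseVec, n_sum_smul_baseVec fun i => (c (baseVec i) : ℝ), hp⟩
  · rintro ⟨a, ha, hp⟩
    refine ⟨Function.extend baseVec a 0, ?_, ?_⟩
    · apply n_injective
      simp only [hinj.extend_apply]
      rw [ha, n_sum_smul_baseVec fun i => (a i : ℝ)]
    · rwa [show Function.extend baseVec a 0 ∘ baseVec = a from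
        funext fun i => hinj.extend_apply a 0 i]

/-- The properties of the simple-root coefficients of a root that matter here: sign coherence
with respect to `φ₁, …, φ₄`, sign coherence with respect to `baseVec`, and two bounds. -/
def IsRootCoeff (x : Fin 4 → ℤ) : Prop :=
  ((∀ i, 0 ≤ x i) ∨ ∀ i, x i ≤ 0) ∧
  ((0 ≤ x 1 ∧ x 0 ≤ x 1 ∧ 0 ≤ x 2 ∧ 0 ≤ x 3) ∨ (x 1 ≤ 0 ∧ x 1 ≤ x 0 ∧ x 2 ≤ 0 ∧ x 3 ≤ 0)) ∧
  (x 0 % 2 = 0 → (x 0).natAbs ≤ (x 1).natAbs) ∧ (x 0 % 2 = 1 → (x 0).natAbs ≤ 1)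

/-- Twice the simple-root coefficients, from twice the standard coordinates. -/
def doubledCoeff (y : Fin 4 → ℤ) : Fin 4 → ℤ :=
  ![y 1 + y 0, y 1 + y 2 + 2 * y 0, y 1 + y 2 + y 3 + 3 * y 0, 2 * y 0]

/-- `y` lists the doubled standard coordinates of a vector with integral simple-root
coefficients satisfying `IsRootCoeff`. -/
def IsDoubledRoot (y : Fin 4 → ℤ) : Prop :=
  (∀ i, 2 * (doubledCoeff y i / 2) = doubledCoeff y i) ∧ IsRootCoeff fun i => doubledCoeff y i / 2

instance : DecidablePred IsDoubledRoot := fun _ => by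
  unfold IsDoubledRoot IsRootCoeff; infer_instance

lemma two_mul_n {α : V} {y : Fin 4 → ℤ} (h : ∀ i, 2 * α i = y i) (i : Fin 4) :
    2 * n α i = doubledCoeff y i := by
  have h0 := h 0
  have h1 := h 1
  have h2 := h 2
  have h3 := h 3
  fin_cases i <;> simp [doubledCoeff] <;> linarith

lemma isDoubledRoot_short (b : Bool) (i : Fin 4) :
    IsDoubledRoot (Pi.single i (if b then 2 else -2)) := by
  revert b i; decide

lemma isDoubledRoot_long (b c : Bool) (i j : Fin 4) (hij : i < j) :
    IsDoubledRoot
      (Pi.single i (if b then 2 else -2) + Pi.single j (if c then 2 else -2)) := by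
  revert b c i j; decide

lemma isDoubledRoot_half (t : Fin 4 → Bool) :
    IsDoubledRoot fun i => if t i then 1 else -1 := by
  revert t; decide

lemma exists_isDoubledRoot {α : V} (hα : α ∈ Δ) :
    ∃ y, IsDoubledRoot y ∧ ∀ i, 2 * α i = y i := by
  simp only [Δ, Set.mem_union, Set.mem_iUnion, Set.mem_insert_iff, Set.mem_singleton_iff,
    Set.mem_ofPred_eq, exists_prop] at hα
  rcases hα with (⟨i, h⟩ | ⟨i, j, hij, h⟩) | ⟨s, hs, rfl⟩
  · obtain ⟨b, rfl⟩ : ∃ b : Bool, α = if b then e i else -e i := by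
      rcases h with rfl | rfl
      exacts [⟨true, rfl⟩, ⟨false, rfl⟩]
    refine ⟨_, isDoubledRoot_short b i, fun k => ?_⟩
    cases b <;> by_cases hk : k = i <;> simp [e, hk]
  · obtain ⟨b, c, rfl⟩ : ∃ b c : Bool,
        α = (if b then e i else -e i) + if c then e j else -e j := by
      rcases h with rfl | rfl | rfl | rfl
      exacts [⟨true, true, rfl⟩, ⟨true, false, sub_eq_add_neg _ _⟩, ⟨false, true, rfl⟩,
        ⟨false, false, sub_eq_add_neg _ _⟩]
    refine ⟨_, isDoubledRoot_long b c i j hij, fun k => ?_⟩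
    cases b <;> cases c <;> by_cases hk : k = i <;> by_cases hk' : k = j <;>
      simp [e, hk, hk', hij.ne, hij.ne']
  · classical
    refine ⟨_, isDoubledRoot_half fun i => decide (s i = 1), fun k => ?_⟩
    have hsum : (∑ i, s i • e i) k = s k := by
      simp [e, Finset.sum_apply, Pi.single_apply]
    rw [Pi.smul_apply, hsum]
    rcases hs k with h | h <;> norm_num [h]

lemma exists_isRootCoeff {α : V} (hα : α ∈ Δ) :
    ∃ x : Fin 4 → ℤ, IsRootCoeff x ∧ ∀ i, n α i = x i := by
  obtain ⟨y, ⟨heven, hy⟩, hαy⟩ := exists_isDoubledRoot hα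
  refine ⟨_, hy, fun i => ?_⟩
  have h := two_mul_n hαy i
  rw [← heven i] at h
  push_cast at h
  linarith

lemma neg_mem_Δ {α : V} (hα : α ∈ Δ) : -α ∈ Δ := by
  simp only [Δ, Set.mem_union, Set.mem_iUnion, Set.mem_insert_iff, Set.mem_singleton_iff,
    Set.mem_ofPred_eq, exists_prop] at hα ⊢
  rcases hα with (⟨i, rfl | rfl⟩ | ⟨i, j, hij, h⟩) | ⟨s, hs, rfl⟩
  · exact .inl (.inl ⟨i, .inr rfl⟩)
  · exact .inl (.inl ⟨i, .inl (neg_neg _)⟩)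
  · refine .inl (.inr ⟨i, j, hij, ?_⟩)
    rcases h with rfl | rfl | rfl | rfl
    · exact .inr (.inr (.inr (by abel)))
    · exact .inr (.inr (.inl (by abel)))
    · exact .inr (.inl (by abel))
    · exact .inl (by abel)
  · refine .inr ⟨-s, fun i => ?_, by simp⟩
    rcases hs i with h | h <;> simp [h]

lemma e_sub_e_mem_Δ {i j : Fin 4} (hij : i < j) : e i - e j ∈ Δ :=
  .inl (.inr (Set.mem_iUnion.2 ⟨i, Set.mem_iUnion.2 ⟨j, Set.mem_iUnion.2 ⟨hij, by simp⟩⟩⟩))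

lemma baseVec_mem_Δ (i : Fin 4) : baseVec i ∈ Δ := by
  fin_cases i
  · have h : φ₁ + φ₂ = e 1 - e 3 := by simp [φ₁, φ₂]
    change φ₁ + φ₂ ∈ Δ
    rw [h]
    exact e_sub_e_mem_Δ (by decide)
  · exact neg_mem_Δ (e_sub_e_mem_Δ (by decide))
  · exact .inl (.inl (Set.mem_iUnion.2 ⟨3, .inl rfl⟩))
  · refine .inr ⟨![1, -1, -1, -1], fun i => by fin_cases i <;> simp, ?_⟩
    simp [baseVec, φ₄, Fin.sum_univ_four, sub_eq_add_neg]

lemma eq_baseVec_coeff_iff {α : V} {x : Fin 4 → ℤ} (hx : ∀ i, n α i = x i) (a : Fin 4 → ℤ) :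
    n α = ![(a 0 : ℝ) - a 1, a 0, a 2, a 3] ↔ a = ![x 1, x 1 - x 0, x 2, x 3] := by
  have hx' : n α = fun i => (x i : ℝ) := funext hx
  rw [hx']
  simp only [funext_iff, Fin.forall_fin_succ, Fin.isValue]
  simp
  norm_cast
  omega

lemma isBase_image_baseVec : IsBase (Finset.univ.image baseVec) := by
  refine ⟨?_, ?_, fun α hα => ?_⟩
  · simpa [Set.range_subset_iff] using baseVec_mem_Δ
  · have h := linearIndependent_baseVec.linearIndepOn_id
    rw [← Set.image_univ, ← Finset.coe_univ, ← Finset.coe_image] at h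
    exact h
  · obtain ⟨x, hx, hαx⟩ := exists_isRootCoeff hα
    have h := (exists_coeff_image_iff α fun a => (∀ i, 0 ≤ a i) ∨ ∀ i, a i ≤ 0).2
      ⟨_, (eq_baseVec_coeff_iff hαx _).2 rfl, by
        simpa [Fin.forall_fin_succ] using hx.2.1⟩
    simpa using h

lemma mem_posOf_image_baseVec_iff {α : V} (hα : α ∈ Δ) {x : Fin 4 → ℤ}
    (hx : ∀ i, n α i = x i) :
    α ∈ posOf (Finset.univ.image baseVec) ↔ 0 ≤ x 1 ∧ x 0 ≤ x 1 ∧ 0 ≤ x 2 ∧ 0 ≤ x 3 := by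
  have h := exists_coeff_image_iff α fun a => ∀ i, 0 ≤ a i
  simp only [eq_baseVec_coeff_iff hx, exists_eq_left] at h
  simpa [posOf, hα, Finset.forall_mem_image, -Finset.mem_image, Fin.forall_fin_succ] using h

lemma mem_Δp_iff {α : V} (hα : α ∈ Δ) {x : Fin 4 → ℤ} (hx : ∀ i, n α i = x i) :
    α ∈ Δp ↔ ∀ i, 0 ≤ x i := by
  simp [Δp, hα, hx]

lemma mem_Δk_iff {α : V} (hα : α ∈ Δ) {x : Fin 4 → ℤ} (hx : ∀ i, n α i = x i) :
    α ∈ Δk ↔ x 0 % 2 = 0 := by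
  simp only [Δk, Set.mem_ofPred_eq, hα, true_and, hx]
  norm_cast
  exact ⟨fun ⟨m, hm⟩ => by omega, fun h => ⟨x 0 / 2, by omega⟩⟩

lemma mem_Δn_iff {α : V} (hα : α ∈ Δ) {x : Fin 4 → ℤ} (hx : ∀ i, n α i = x i) :
    α ∈ Δn ↔ x 0 % 2 = 1 := by
  simp only [Δn, Set.mem_ofPred_eq, hα, true_and, hx]
  norm_cast
  exact ⟨fun ⟨m, hm⟩ => by omega, fun h => ⟨x 0 / 2, by omega⟩⟩

lemma le'_iff_of_coeff {β γ : V} {x y : Fin 4 → ℤ} (hx : ∀ i, n γ i = x i)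
    (hy : ∀ i, n β i = y i) : le' γ β ↔ ∀ i, x i ≤ y i := by
  rw [le'_iff]
  simp only [hx, hy]
  norm_cast
  exact ⟨fun ⟨c, hc⟩ i => by have := hc i; omega,
    fun h => ⟨fun i => (y i - x i).toNat, fun i => by have := h i; simp; omega⟩⟩

lemma mem_decomposition_iff {α : V} (hα : α ∈ Δ) {x : Fin 4 → ℤ} (hx : ∀ i, n α i = x i) :
    α ∈ Δkp ∪ {β ∈ Δnp | le' (φ₁ + φ₂) β} ∪ (Neg.neg '' {β ∈ Δnp | le' β (φ₁)}) ↔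
      (((∀ i, 0 ≤ x i) ∧ x 0 % 2 = 0) ∨
        (((∀ i, 0 ≤ x i) ∧ x 0 % 2 = 1) ∧ ∀ i, (![1, 1, 0, 0] : Fin 4 → ℤ) i ≤ x i)) ∨
      (((∀ i, 0 ≤ -x i) ∧ -x 0 % 2 = 1) ∧ ∀ i, -x i ≤ (![1, 0, 0, 0] : Fin 4 → ℤ) i) := by
  have hneg : ∀ i, n (-α) i = ((-x i : ℤ) : ℝ) := fun i => by simp [n_neg, hx, -n_zero]
  have h₁ : ∀ i, n φ₁ i = ((![1, 0, 0, 0] : Fin 4 → ℤ) i : ℝ) := fun i => by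
    rw [n_φ₁]; fin_cases i <;> simp
  have h₂ : ∀ i, n (φ₁ + φ₂) i = ((![1, 1, 0, 0] : Fin 4 → ℤ) i : ℝ) := fun i => by
    rw [n_φ₁_add_φ₂]; fin_cases i <;> simp
  rw [Set.image_neg_eq_neg]
  simp only [Set.mem_union, Set.mem_neg, Set.mem_ofPred_eq, Δkp, Δnp, Set.mem_inter_iff,
    mem_Δp_iff hα hx, mem_Δk_iff hα hx, mem_Δn_iff hα hx, mem_Δp_iff (neg_mem_Δ hα) hneg,
    mem_Δn_iff (neg_mem_Δ hα) hneg, le'_iff_of_coeff h₂ hx, le'_iff_of_coeff hneg h₁]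

lemma posOf_image_baseVec : posOf (Finset.univ.image baseVec) =
    Δkp ∪ {β ∈ Δnp | le' (φ₁ + φ₂) β} ∪ (Neg.neg '' {β ∈ Δnp | le' β (φ₁)}) := by
  ext α
  by_cases hα : α ∈ Δ
  · obtain ⟨x, ⟨hs, hb, hk, hn⟩, hx⟩ := exists_isRootCoeff hα
    rw [mem_posOf_image_baseVec_iff hα hx, mem_decomposition_iff hα hx]
    simp [Fin.forall_fin_succ] at hs ⊢
    omega
  · refine iff_of_false (fun h => hα h.1) ?_
    rintro ((h | h) | ⟨β, h, rfl⟩)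
    exacts [hα h.1.1, hα h.1.1.1, hα (neg_mem_Δ h.1.1.1)]

theorem stmt6 :
    IsBase ({φ₁ + φ₂, -(φ₁), φ₃, φ₄} : Finset V) ∧
    posOf ({φ₁ + φ₂, -(φ₁), φ₃, φ₄} : Finset V) =
      Δkp ∪ {β ∈ Δnp | le' (φ₁ + φ₂) β} ∪ (Neg.neg '' {β ∈ Δnp | le' β (φ₁)}) ∧
    Δkp ⊆ posOf ({φ₁ + φ₂, -(φ₁), φ₃, φ₄} : Finset V) := by
  rw [base_eq_image]
  refine ⟨isBase_image_baseVec, posOf_image_baseVec, ?_⟩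
  rw [posOf_image_baseVec]
  exact fun α hα => .inl (.inl hα)
end
end
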